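/- The 4×4 Jacobian of the flux of the isothermal two-phase model (∂_t ρ + ∂_x(ρu) = 0, ∂_t ρᵢ + ∂_x(ρᵢ u) = 0 for i=1,2, ∂_t(ρu) + ∂_x(ρu² + α₁p(ρ₁)+α₂p(ρ₂)) = 0) has eigenvalues u-c, u, u, u+c with c² = (α₁ρ₁p'(ρ₁) + α₂ρ₂p'(ρ₂))/ρ; in particular the system is hyperbolic whenever α₁ρ₁p'(ρ₁) + α₂ρ₂p'(ρ₂) > 0. -/

import Mathlib

open Polynomial

/-- Flux of the isothermal two-phase model in the conservative variables
`w = (ρ, ρ₁, ρ₂, q)` with `u = q/ρ`, `α₁ = (ρ-ρ₂)/(ρ₁-ρ₂)`, `α₂ = 1-α₁`. -/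
noncomputable def twoPhaseFlux (p : ℝ → ℝ) (w : Fin 4 → ℝ) : Fin 4 → ℝ :=
  ![w 3,
    w 1 * (w 3 / w 0),
    w 2 * (w 3 / w 0),
    w 3 ^ 2 / w 0 + ((w 0 - w 2) / (w 1 - w 2)) * p (w 1)
      + (1 - (w 0 - w 2) / (w 1 - w 2)) * p (w 2)]

/-- Jacobian matrix of the flux at a state `w`. -/
noncomputable def twoPhaseJacobian (p : ℝ → ℝ) (w : Fin 4 → ℝ) : Matrix (Fin 4) (Fin 4) ℝ :=
  fun i j => fderiv ℝ (fun v : Fin 4 → ℝ => twoPhaseFlux p v i) w (Pi.single j 1)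

/-- The derivative of the two-phase flux, entrywise. -/
theorem twoPhaseJacobian_eq {p : ℝ → ℝ} (hp : Differentiable ℝ p) {ρ ρ₁ ρ₂ q u α₁ : ℝ}
    (hρ : ρ ≠ 0) (hne : ρ₁ ≠ ρ₂) (hu : u = q / ρ) (hα₁ : α₁ = (ρ - ρ₂) / (ρ₁ - ρ₂)) :
    twoPhaseJacobian p ![ρ, ρ₁, ρ₂, q] =
      !![0, 0, 0, 1;
         -(ρ₁ * u / ρ), u, 0, ρ₁ / ρ;
         -(ρ₂ * u / ρ), 0, u, ρ₂ / ρ;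
         (p ρ₁ - p ρ₂) / (ρ₁ - ρ₂) - u ^ 2,
         α₁ * (deriv p ρ₁ - (p ρ₁ - p ρ₂) / (ρ₁ - ρ₂)),
         (1 - α₁) * (deriv p ρ₂ - (p ρ₁ - p ρ₂) / (ρ₁ - ρ₂)),
         2 * u] := by
  have hd : ρ₁ - ρ₂ ≠ 0 := sub_ne_zero.mpr hne
  set w : Fin 4 → ℝ := ![ρ, ρ₁, ρ₂, q] with hw
  have hx (i : Fin 4) : HasFDerivAt (fun v : Fin 4 → ℝ => v i)
      (ContinuousLinearMap.proj (R := ℝ) (φ := fun _ : Fin 4 => ℝ) i) w :=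
    hasFDerivAt_apply i w
  have hinv : HasFDerivAt (fun v : Fin 4 → ℝ => (v 0)⁻¹) _ w :=
    (hasDerivAt_inv (x := w 0) hρ).comp_hasFDerivAt w (hx 0)
  have hinv' : HasFDerivAt (fun v : Fin 4 → ℝ => (v 1 - v 2)⁻¹) _ w :=
    (hasDerivAt_inv (x := w 1 - w 2) hd).comp_hasFDerivAt w ((hx 1).sub (hx 2))
  have hp' (i : Fin 4) : HasFDerivAt (fun v : Fin 4 → ℝ => p (v i)) _ w :=
    (hp (w i)).hasDerivAt.comp_hasFDerivAt w (hx i)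
  have hα := ((hx 0).sub (hx 2)).mul hinv'
  have h₁ := ((hx 1).mul ((hx 3).mul hinv)).fderiv
  have h₂ := ((hx 2).mul ((hx 3).mul hinv)).fderiv
  have h₃ := (((((hx 3).pow 2).mul hinv).add (hα.mul (hp' 1))).add
    ((hα.const_sub 1).mul (hp' 2))).fderiv
  have e₀ (j : Fin 4) : twoPhaseJacobian p w 0 j = _ :=
    DFunLike.congr_fun (hx 3).fderiv (Pi.single j 1)
  have e₁ (j : Fin 4) : twoPhaseJacobian p w 1 j = _ :=
    DFunLike.congr_fun h₁ (Pi.single j 1)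
  have e₂ (j : Fin 4) : twoPhaseJacobian p w 2 j = _ :=
    DFunLike.congr_fun h₂ (Pi.single j 1)
  have e₃ (j : Fin 4) : twoPhaseJacobian p w 3 j = _ :=
    DFunLike.congr_fun h₃ (Pi.single j 1)
  subst hu hα₁
  ext i j
  fin_cases i
  · refine (e₀ j).trans ?_
    fin_cases j <;> simp
  · refine (e₁ j).trans ?_
    fin_cases j <;> simp [hw] <;> field_simp
  · refine (e₂ j).trans ?_
    fin_cases j <;> simp [hw] <;> field_simp
  · refine (e₃ j).trans ?_
    fin_cases j <;> simp [hw] <;> field_simp <;> ring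

/-- Right eigenvectors of a matrix of the form of the two-phase Jacobian, as columns; the middle two
are the projections along `(ρ, ρ₁, ρ₂)` of the second and third basis vectors. -/
def twoPhaseEigenvectors (ρ ρ₁ ρ₂ u c β δ : ℝ) : Matrix (Fin 4) (Fin 4) ℝ :=
  !![ρ, -(β * ρ), -(δ * ρ), ρ;
     ρ₁, 1 - β * ρ₁, -(δ * ρ₁), ρ₁;
     ρ₂, -(β * ρ₂), 1 - δ * ρ₂, ρ₂;
     ρ * (u - c), -(β * ρ * u), -(δ * ρ * u), ρ * (u + c)]

theorem det_twoPhaseEigenvectors (ρ ρ₁ ρ₂ u c β δ : ℝ) :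
    (twoPhaseEigenvectors ρ ρ₁ ρ₂ u c β δ).det = 2 * c * ρ ^ 2 := by
  simp [twoPhaseEigenvectors, Matrix.det_succ_row_zero, Fin.sum_univ_succ, Fin.succAbove]
  ring

theorem mul_twoPhaseEigenvectors {ρ ρ₁ ρ₂ u c a b d : ℝ} (hρ : ρ ≠ 0) (hc : c ≠ 0)
    (h : a * ρ + b * ρ₁ + d * ρ₂ = ρ * c ^ 2) :
    !![0, 0, 0, 1;
       -(ρ₁ * u / ρ), u, 0, ρ₁ / ρ;
       -(ρ₂ * u / ρ), 0, u, ρ₂ / ρ;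
       a - u ^ 2, b, d, 2 * u] *
        twoPhaseEigenvectors ρ ρ₁ ρ₂ u c (b / (ρ * c ^ 2)) (d / (ρ * c ^ 2)) =
      twoPhaseEigenvectors ρ ρ₁ ρ₂ u c (b / (ρ * c ^ 2)) (d / (ρ * c ^ 2)) *
        Matrix.diagonal ![u - c, u, u, u + c] := by
  have hb : b / (ρ * c ^ 2) * (ρ * c ^ 2) = b := by field_simp
  have hd : d / (ρ * c ^ 2) * (ρ * c ^ 2) = d := by field_simp
  generalize b / (ρ * c ^ 2) = β at *
  generalize d / (ρ * c ^ 2) = δ at *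
  ext i j
  rw [Matrix.mul_diagonal]
  fin_cases i
  · fin_cases j <;> simp [twoPhaseEigenvectors, Matrix.mul_apply, Fin.sum_univ_succ]
  · fin_cases j <;> simp [twoPhaseEigenvectors, Matrix.mul_apply, Fin.sum_univ_succ] <;>
      field_simp <;> ring
  · fin_cases j <;> simp [twoPhaseEigenvectors, Matrix.mul_apply, Fin.sum_univ_succ] <;>
      field_simp <;> ring
  · fin_cases j <;> simp [twoPhaseEigenvectors, Matrix.mul_apply, Fin.sum_univ_succ]
    · linear_combination h
    · linear_combination -β * h - hb
    · linear_combination -δ * h - hd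
    · linear_combination h

/-- The Jacobian of the flux has characteristic polynomial
`(X-(u-c))(X-u)²(X-(u+c))` where `c² = (α₁ρ₁p'(ρ₁)+α₂ρ₂p'(ρ₂))/ρ`, and the
system is hyperbolic (Jacobian diagonalizable with real eigenvalues
`u-c, u, u, u+c`) whenever `α₁ρ₁p'(ρ₁)+α₂ρ₂p'(ρ₂) > 0`. -/
theorem twoPhase_hyperbolic (p : ℝ → ℝ) (hp : Differentiable ℝ p)
    (ρ ρ₁ ρ₂ q u c α₁ α₂ : ℝ) (hρ : 0 < ρ) (hne : ρ₁ ≠ ρ₂)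
    (hu : u = q / ρ)
    (hα₁ : α₁ = (ρ - ρ₂) / (ρ₁ - ρ₂)) (hα₂ : α₂ = 1 - α₁)
    (hc : c = Real.sqrt ((α₁ * ρ₁ * deriv p ρ₁ + α₂ * ρ₂ * deriv p ρ₂) / ρ))
    (hpos : 0 < α₁ * ρ₁ * deriv p ρ₁ + α₂ * ρ₂ * deriv p ρ₂) :
    (twoPhaseJacobian p ![ρ, ρ₁, ρ₂, q]).charpoly =
        (X - C (u - c)) * (X - C u) ^ 2 * (X - C (u + c)) ∧
      ∃ P : Matrix (Fin 4) (Fin 4) ℝ, IsUnit P.det ∧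
        P⁻¹ * twoPhaseJacobian p ![ρ, ρ₁, ρ₂, q] * P =
          Matrix.diagonal ![u - c, u, u, u + c] := by
  have hcpos : 0 < c := hc ▸ Real.sqrt_pos.mpr (div_pos hpos hρ)
  have hc2 : ρ * c ^ 2 = α₁ * ρ₁ * deriv p ρ₁ + α₂ * ρ₂ * deriv p ρ₂ := by
    rw [hc, Real.sq_sqrt (div_pos hpos hρ).le]
    field_simp
  have hmean : α₁ * (ρ₁ - ρ₂) = ρ - ρ₂ := by
    rw [hα₁, div_mul_cancel₀ _ (sub_ne_zero.mpr hne)]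
  have hJP := mul_twoPhaseEigenvectors (ρ := ρ) (ρ₁ := ρ₁) (ρ₂ := ρ₂) (u := u) (c := c)
    (a := (p ρ₁ - p ρ₂) / (ρ₁ - ρ₂))
    (b := α₁ * (deriv p ρ₁ - (p ρ₁ - p ρ₂) / (ρ₁ - ρ₂)))
    (d := (1 - α₁) * (deriv p ρ₂ - (p ρ₁ - p ρ₂) / (ρ₁ - ρ₂))) hρ.ne' hcpos.ne' (by
      rw [hc2, hα₂]
      linear_combination -((p ρ₁ - p ρ₂) / (ρ₁ - ρ₂)) * hmean)
  rw [← twoPhaseJacobian_eq hp hρ.ne' hne hu hα₁] at hJP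
  generalize hP : twoPhaseEigenvectors ρ ρ₁ ρ₂ u c _ _ = P at hJP
  have hdet : IsUnit P.det := by
    rw [← hP, det_twoPhaseEigenvectors]
    exact (by positivity : 2 * c * ρ ^ 2 ≠ 0).isUnit
  have hdiag : P⁻¹ * twoPhaseJacobian p ![ρ, ρ₁, ρ₂, q] * P =
      Matrix.diagonal ![u - c, u, u, u + c] := by
    rw [Matrix.mul_assoc, hJP, Matrix.nonsing_inv_mul_cancel_left _ _ hdet]
  refine ⟨?_, P, hdet, hdiag⟩
  have hchar := congrArg Matrix.charpoly hdiag
  rw [Matrix.mul_assoc, Matrix.charpoly_mul_comm, Matrix.mul_assoc, Matrix.mul_nonsing_inv _ hdet,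
    Matrix.mul_one] at hchar
  rw [hchar, Matrix.charpoly_diagonal]
  simp [Fin.prod_univ_succ]
  ring
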